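/- Ti₂(2 + √3) = (2/3)·G − (π/12)·log(362 − 209·√3). -/

import Mathlib

open Real MeasureTheory intervalIntegral Finset

/-- Inverse tangent integral Ti₂(x) = ∫₀ˣ arctan u / u du. -/
noncomputable def Ti2 (x : ℝ) : ℝ := ∫ u in (0:ℝ)..x, Real.arctan u / u

/-- Catalan's constant G = Σ_{k≥0} (-1)^k/(2k+1)². -/
noncomputable def catalanG : ℝ := ∑' k : ℕ, (-1 : ℝ) ^ k / (2 * (k : ℝ) + 1) ^ 2


lemma atq_norm_le (u : ℝ) : ‖Real.arctan u / u‖ ≤ 1 := by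
  have key : ∀ x : ℝ, 0 ≤ x → Real.arctan x ≤ x := by
    intro x hx
    have h := Real.le_tan (Real.arctan_nonneg.2 hx) (Real.arctan_lt_pi_div_two x)
    rwa [Real.tan_arctan] at h
  rw [norm_div, Real.norm_eq_abs, Real.norm_eq_abs]
  apply div_le_one_of_le₀ _ (abs_nonneg _)
  rcases le_total 0 u with h | h
  · rw [abs_of_nonneg h, abs_of_nonneg (Real.arctan_nonneg.2 h)]; exact key u h
  · have := key (-u) (by linarith)
    rw [Real.arctan_neg] at this
    rw [abs_of_nonpos h, abs_of_nonpos (Real.arctan_le_zero.2 h)]; exact this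

lemma atq_meas : Measurable (fun u : ℝ => Real.arctan u / u) :=
  Real.measurable_arctan.div measurable_id

lemma atq_ii (a b : ℝ) : IntervalIntegrable (fun u : ℝ => Real.arctan u / u) volume a b := by
  apply (intervalIntegrable_const (c := (1:ℝ))).mono_fun atq_meas.aestronglyMeasurable
  filter_upwards with u
  simpa using atq_norm_le u

lemma Ti2_cont : Continuous Ti2 :=
  intervalIntegral.continuous_primitive atq_ii 0

lemma Ti2_deriv {x : ℝ} (hx : 0 < x) : HasDerivAt Ti2 (Real.arctan x / x) x := by
  apply intervalIntegral.integral_hasDerivAt_right (atq_ii 0 x)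
  · exact atq_meas.stronglyMeasurable.stronglyMeasurableAtFilter
  · exact Real.continuous_arctan.continuousAt.div continuousAt_id hx.ne'

lemma Ti2_one : Ti2 1 = catalanG := by
  have hs : Summable (fun k : ℕ => 1 / (2 * (k : ℝ) + 1) ^ 2) := by
    have h := (Real.summable_one_div_nat_pow (p := 2)).2 (by norm_num)
    have h2 := h.comp_injective (i := fun k : ℕ => 2 * k + 1) (fun a b h => by simpa using h)
    refine h2.congr (fun k => ?_)
    simp
  let F : ℕ → ℝ → ℝ := fun k u => (-1 : ℝ) ^ k * u ^ (2 * k) / (2 * (k : ℝ) + 1)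
  have hF : ∀ k, Continuous (F k) := fun k => by
    simp only [F]; fun_prop
  have hint : ∀ k : ℕ, ∫ u in (0:ℝ)..1, u ^ (2 * k) / (2 * (k : ℝ) + 1)
      = 1 / (2 * (k : ℝ) + 1) ^ 2 := by
    intro k
    rw [intervalIntegral.integral_div, integral_pow]
    have : (2 * (k : ℝ) + 1) ≠ 0 := by positivity
    push_cast
    simp
    field_simp
  have h1 : ∀ k, ∫ u in Set.Ioc (0:ℝ) 1, F k u = (-1 : ℝ) ^ k / (2 * (k : ℝ) + 1) ^ 2 := by
    intro k
    rw [← intervalIntegral.integral_of_le zero_le_one]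
    have : ∀ u, F k u = (-1 : ℝ) ^ k * (u ^ (2 * k) / (2 * (k : ℝ) + 1)) := by
      intro u; simp only [F]; ring
    simp_rw [this]
    rw [intervalIntegral.integral_const_mul, hint]; ring
  have h2 : ∀ k, ∫ u in Set.Ioc (0:ℝ) 1, ‖F k u‖ = 1 / (2 * (k : ℝ) + 1) ^ 2 := by
    intro k
    rw [← intervalIntegral.integral_of_le zero_le_one, ← hint]
    congr 1
    ext u
    have : (0:ℝ) < 2 * (k : ℝ) + 1 := by positivity
    simp [F, abs_of_pos this, pow_mul]
  have h3 := MeasureTheory.hasSum_integral_of_summable_integral_norm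
    (μ := volume.restrict (Set.Ioc (0:ℝ) 1)) (F := F)
    (fun k => (hF k).integrableOn_Ioc) (by simp_rw [h2]; exact hs)
  simp_rw [h1] at h3
  rw [catalanG, h3.tsum_eq, Ti2, intervalIntegral.integral_of_le zero_le_one]
  apply MeasureTheory.integral_congr_ae
  rw [Filter.EventuallyEq, ae_restrict_iff' measurableSet_Ioc]
  have hne : ∀ᵐ u : ℝ, u ≠ 1 := by
    simp [ae_iff]
  filter_upwards [hne] with u hu1 hu
  have hlt : u < 1 := lt_of_le_of_ne hu.2 hu1
  have hu0 := hu.1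
  have h4 := (Real.hasSum_arctan (x := u) (by
    rw [Real.norm_eq_abs, abs_of_pos hu0]; exact hlt)).div_const u
  rw [← h4.tsum_eq]
  congr 1
  ext k
  simp only [F]
  push_cast
  field_simp
  ring

noncomputable def PhiT (t : ℝ) : ℝ := Ti2 (Real.tan t) - t * Real.log (Real.tan t)

lemma PhiT_deriv {t : ℝ} (h0 : 0 < t) (h1 : t < π / 2) :
    HasDerivAt PhiT (-Real.log (Real.tan t)) t := by
  have hc : 0 < Real.cos t := Real.cos_pos_of_mem_Ioo ⟨by linarith, h1⟩
  have ht : 0 < Real.tan t := Real.tan_pos_of_pos_of_lt_pi_div_two h0 h1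
  have hd := Real.hasDerivAt_tan hc.ne'
  have h2 := (Ti2_deriv ht).comp t hd
  have h3 := (hasDerivAt_id t).mul (hd.log ht.ne')
  have h4 := h2.sub h3
  rw [Real.arctan_tan (by linarith) h1] at h4
  refine h4.congr_deriv ?_
  simp only [id]
  ring

lemma PhiT_zero : Filter.Tendsto PhiT (nhdsWithin 0 (Set.Ioi 0)) (nhds 0) := by
  have htan : Filter.Tendsto Real.tan (nhdsWithin 0 (Set.Ioi 0)) (nhds 0) := by
    have : ContinuousAt Real.tan 0 := Real.continuousAt_tan.2 (by simp)
    have h := this.tendsto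
    rw [Real.tan_zero] at h
    exact h.mono_left nhdsWithin_le_nhds
  have hA : Filter.Tendsto (fun t => Ti2 (Real.tan t)) (nhdsWithin 0 (Set.Ioi 0)) (nhds 0) := by
    have h := (Ti2_cont.tendsto 0).comp htan
    rw [show Ti2 0 = 0 by simp [Ti2]] at h
    exact h
  have hB : Filter.Tendsto (fun t => t * Real.log (Real.tan t))
      (nhdsWithin 0 (Set.Ioi 0)) (nhds 0) := by
    have h := ((Real.continuous_mul_log.tendsto 0).comp htan).norm
    simp only [zero_mul, norm_zero] at h
    refine squeeze_zero_norm' ?_ h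
    have : Set.Ioo (0:ℝ) (π/2) ∈ nhdsWithin (0:ℝ) (Set.Ioi 0) :=
      Ioo_mem_nhdsGT (by positivity)
    filter_upwards [this] with t ht
    simp only [Function.comp, norm_mul]
    gcongr
    rw [Real.norm_eq_abs, Real.norm_eq_abs, abs_of_pos ht.1]
    exact (Real.le_tan ht.1.le ht.2).trans (le_abs_self _)
  have h := hA.sub hB
  rw [sub_zero] at h
  exact h

lemma const_Ioo {f : ℝ → ℝ} {a b : ℝ} (h : ∀ t ∈ Set.Ioo a b, HasDerivAt f 0 t) {x y : ℝ}
    (hx : x ∈ Set.Ioo a b) (hy : y ∈ Set.Ioo a b) : f x = f y :=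
  isOpen_Ioo.is_const_of_deriv_eq_zero isPreconnected_Ioo
    (fun t ht => (h t ht).differentiableAt.differentiableWithinAt)
    (fun t ht => (h t ht).deriv) hx hy

lemma PhiT_refl : PhiT (π / 12) = PhiT (5 * π / 12) := by
  have hpi := Real.pi_pos
  have h : ∀ t ∈ Set.Ioo 0 (π / 2), HasDerivAt (fun t => PhiT t - PhiT (π / 2 - t)) 0 t := by
    intro t ht
    have h1 := PhiT_deriv ht.1 ht.2
    have h2 := (PhiT_deriv (t := π / 2 - t) (by linarith [ht.2]) (by linarith [ht.1])).comp t
      ((hasDerivAt_id t).const_sub (π / 2))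
    refine (h1.sub h2).congr_deriv ?_
    rw [Real.tan_pi_div_two_sub, Real.log_inv]
    ring
  have := const_Ioo h (x := π / 12) (y := π / 4) ⟨by linarith, by linarith⟩
    ⟨by linarith, by linarith⟩
  rw [show π / 2 - π / 12 = 5 * π / 12 by ring, show π / 2 - π / 4 = π / 4 by ring] at this
  linarith

lemma tan_triple (t : ℝ) :
    Real.tan (3 * t) = Real.tan t * Real.tan (π / 3 - t) * Real.tan (π / 3 + t) := by
  have h3 : Real.sqrt 3 ^ 2 = 3 := Real.sq_sqrt (by norm_num)
  have hsc := Real.sin_sq_add_cos_sq t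
  have hs : Real.sin (3 * t) = 4 * (Real.sin t * Real.sin (π / 3 - t) * Real.sin (π / 3 + t)) := by
    rw [Real.sin_three_mul, Real.sin_sub, Real.sin_add, Real.sin_pi_div_three,
      Real.cos_pi_div_three]
    linear_combination (-Real.sin t * Real.cos t ^ 2) * h3 - 3 * Real.sin t * hsc
  have hc : Real.cos (3 * t) = 4 * (Real.cos t * Real.cos (π / 3 - t) * Real.cos (π / 3 + t)) := by
    rw [Real.cos_three_mul, Real.cos_sub, Real.cos_add, Real.sin_pi_div_three,
      Real.cos_pi_div_three]
    linear_combination (Real.cos t * Real.sin t ^ 2) * h3 + 3 * Real.cos t * hsc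
  simp only [Real.tan_eq_sin_div_cos]
  rw [hs, hc, mul_div_mul_left _ _ (by norm_num : (4:ℝ) ≠ 0)]
  simp only [div_mul_div_comm]

lemma PhiT_triple : PhiT (π / 4) / 3 - PhiT (π / 12) + PhiT (π / 4) - PhiT (5 * π / 12) = 0 := by
  have hpi := Real.pi_pos
  let H : ℝ → ℝ := fun t => PhiT (3 * t) / 3 - PhiT t + PhiT (π / 3 - t) - PhiT (π / 3 + t)
  have h : ∀ t ∈ Set.Ioo 0 (π / 6), HasDerivAt H 0 t := by
    rintro t ⟨h0, h6⟩
    have h1 := ((PhiT_deriv (t := 3 * t) (by linarith) (by linarith)).comp t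
      ((hasDerivAt_id t).const_mul 3)).div_const 3
    have h2 := PhiT_deriv (t := t) (by linarith) (by linarith)
    have h3 := (PhiT_deriv (t := π / 3 - t) (by linarith) (by linarith)).comp t
      ((hasDerivAt_id t).const_sub (π / 3))
    have h4 := (PhiT_deriv (t := π / 3 + t) (by linarith) (by linarith)).comp t
      ((hasDerivAt_id t).const_add (π / 3))
    refine (((h1.sub h2).add h3).sub h4).congr_deriv ?_
    have p1 := Real.tan_pos_of_pos_of_lt_pi_div_two (x := t) (by linarith) (by linarith)
    have p2 := Real.tan_pos_of_pos_of_lt_pi_div_two (x := π / 3 - t) (by linarith) (by linarith)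
    have p3 := Real.tan_pos_of_pos_of_lt_pi_div_two (x := π / 3 + t) (by linarith) (by linarith)
    rw [tan_triple, Real.log_mul (by positivity) (by positivity),
      Real.log_mul (by positivity) (by positivity)]
    ring
  have hlim : Filter.Tendsto H (nhdsWithin 0 (Set.Ioi 0)) (nhds 0) := by
    have hcont : ContinuousAt PhiT (π / 3) :=
      (PhiT_deriv (by linarith) (by linarith)).continuousAt
    have hw : Filter.Tendsto (fun t : ℝ => 3 * t) (nhdsWithin 0 (Set.Ioi 0))
        (nhdsWithin 0 (Set.Ioi 0)) := by
      apply tendsto_nhdsWithin_iff.2 ⟨?_, ?_⟩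
      · have : Continuous (fun t : ℝ => 3 * t) := by fun_prop
        have h := this.tendsto 0
        simp only [mul_zero] at h
        exact h.mono_left nhdsWithin_le_nhds
      · filter_upwards [self_mem_nhdsWithin] with t ht
        simpa using ht
    have a1 := (PhiT_zero.comp hw).div_const 3
    have b1 : Filter.Tendsto (fun t : ℝ => π / 3 - t) (nhdsWithin 0 (Set.Ioi 0))
        (nhds (π / 3)) := by
      have : Continuous (fun t : ℝ => π / 3 - t) := by fun_prop
      have h := this.tendsto 0
      simp only [sub_zero] at h
      exact h.mono_left nhdsWithin_le_nhds
    have b2 : Filter.Tendsto (fun t : ℝ => π / 3 + t) (nhdsWithin 0 (Set.Ioi 0))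
        (nhds (π / 3)) := by
      have : Continuous (fun t : ℝ => π / 3 + t) := by fun_prop
      have h := this.tendsto 0
      simp only [add_zero] at h
      exact h.mono_left nhdsWithin_le_nhds
    have := ((a1.sub PhiT_zero).add (hcont.tendsto.comp b1)).sub (hcont.tendsto.comp b2)
    simpa [H, Function.comp_def] using this
  have hconst : Filter.Tendsto H (nhdsWithin 0 (Set.Ioi 0)) (nhds (H (π / 12))) := by
    apply tendsto_const_nhds.congr'
    have : Set.Ioo (0:ℝ) (π/6) ∈ nhdsWithin (0:ℝ) (Set.Ioi 0) :=
      Ioo_mem_nhdsGT (by positivity)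
    filter_upwards [this] with t ht
    exact const_Ioo h ⟨by linarith, by linarith⟩ ht
  have := tendsto_nhds_unique hconst hlim
  simp only [H] at this
  rw [show 3 * (π / 12) = π / 4 by ring, show π / 3 - π / 12 = π / 4 by ring,
    show π / 3 + π / 12 = 5 * π / 12 by ring] at this
  exact this

lemma tan_five : Real.tan (5 * π / 12) = 2 + Real.sqrt 3 := by
  have hpi := Real.pi_pos
  have hc : 0 < Real.cos (5 * π / 12) :=
    Real.cos_pos_of_mem_Ioo ⟨by linarith, by linarith⟩
  rw [Real.tan_eq_sin_div_cos, div_eq_iff hc.ne', show 5 * π / 12 = π / 4 + π / 6 by ring,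
    Real.sin_add, Real.cos_add, Real.sin_pi_div_four, Real.cos_pi_div_four,
    Real.sin_pi_div_six, Real.cos_pi_div_six]
  have h3 : Real.sqrt 3 ^ 2 = 3 := Real.sq_sqrt (by norm_num)
  linear_combination (-Real.sqrt 2 / 4) * h3

theorem stmt_10 :
    Ti2 (2 + Real.sqrt 3) =
      (2 / 3) * catalanG - (π / 12) * Real.log (362 - 209 * Real.sqrt 3) := by
  have h3 : Real.sqrt 3 ^ 2 = 3 := Real.sq_sqrt (by norm_num)
  have hlog : Real.log (362 - 209 * Real.sqrt 3) = -(5 * Real.log (2 + Real.sqrt 3)) := by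
    have hp : (2 + Real.sqrt 3) ^ 5 = 362 + 209 * Real.sqrt 3 := by
      linear_combination (Real.sqrt 3 ^ 3 + 10 * Real.sqrt 3 ^ 2 + 43 * Real.sqrt 3 + 110) * h3
    have : 362 - 209 * Real.sqrt 3 = ((2 + Real.sqrt 3) ^ 5)⁻¹ := by
      rw [hp]
      apply eq_inv_of_mul_eq_one_left
      linear_combination (-209 ^ 2) * h3
    rw [this, Real.log_inv, Real.log_pow]
    norm_num
  have h4 : PhiT (π / 4) = catalanG := by
    simp [PhiT, Ti2_one]
  have h5 : PhiT (5 * π / 12) = Ti2 (2 + Real.sqrt 3)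
      - 5 * π / 12 * Real.log (2 + Real.sqrt 3) := by
    rw [PhiT, tan_five]
  have h6 := PhiT_triple
  rw [PhiT_refl, h4, h5] at h6
  rw [hlog]
  linarith
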